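/- arXiv:2506.06197 — 3 statements merged into one kernel-verified Lean document; each statement's English description precedes it below -/
import Mathlib

section
/- Let ρ_1, …, ρ_n be density matrices on ℂ^d prepared with uniform prior 1/n, and let λ = max_x ‖ρ_x‖ be the largest eigenvalue occurring among the states (the maximum of their operator norms). If a POVM (M(x))_{x=1}^n achieves success probability (1/n) ∑_{x=1}^n tr(ρ_x M(x)) = (d/n)·λ, then M(x)·ρ_x = λ·M(x) for every x. -/
open Matrix
open scoped ComplexOrder

open scoped MatrixOrder in
/-- A positive semidefinite complex matrix has the form `Cᴴ * C`. -/
lemma Matrix.PosSemidef.exists_eq_conjTranspose_mul_self {m : Type*} [Fintype m]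
    {A : Matrix m m ℂ} (hA : A.PosSemidef) : ∃ C : Matrix m m ℂ, A = Cᴴ * C := by
  classical
  exact CStarAlgebra.nonneg_iff_eq_star_mul_self.mp hA.nonneg

/-- The trace of a product of two positive semidefinite matrices is nonnegative. -/
lemma Matrix.PosSemidef.trace_mul_nonneg {m : Type*} [Fintype m]
    {A B : Matrix m m ℂ} (hA : A.PosSemidef) (hB : B.PosSemidef) : 0 ≤ (A * B).trace := by
  obtain ⟨C, rfl⟩ := hB.exists_eq_conjTranspose_mul_self
  rw [← Matrix.mul_assoc, Matrix.trace_mul_comm, ← Matrix.mul_assoc]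
  exact (hA.mul_mul_conjTranspose_same C).trace_nonneg

/-- Two positive semidefinite matrices whose product has trace zero have product zero. -/
lemma Matrix.PosSemidef.mul_eq_zero_of_trace_mul_eq_zero {m : Type*} [Fintype m]
    {A B : Matrix m m ℂ} (hA : A.PosSemidef) (hB : B.PosSemidef) (h : (A * B).trace = 0) :
    A * B = 0 := by
  obtain ⟨C, rfl⟩ := hA.exists_eq_conjTranspose_mul_self
  obtain ⟨D, rfl⟩ := hB.exists_eq_conjTranspose_mul_self
  have hCD : C * Dᴴ = 0 := by
    rw [← Matrix.trace_conjTranspose_mul_self_eq_zero_iff, ← h, conjTranspose_mul,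
      conjTranspose_conjTranspose, Matrix.mul_assoc, Matrix.trace_mul_comm]
    simp only [Matrix.mul_assoc]
  calc Cᴴ * C * (Dᴴ * D) = Cᴴ * (C * Dᴴ) * D := by simp only [Matrix.mul_assoc]
    _ = 0 := by simp [hCD]

/-- If `c` bounds all eigenvalues of a Hermitian matrix `A`, then `c • 1 - A` is positive
semidefinite. -/
lemma Matrix.IsHermitian.posSemidef_smul_one_sub {m : Type*} [Fintype m] [DecidableEq m]
    {A : Matrix m m ℂ} (hA : A.IsHermitian) {c : ℝ} (hc : ∀ i, hA.eigenvalues i ≤ c) :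
    ((c : ℂ) • (1 : Matrix m m ℂ) - A).PosSemidef := by
  have hD : (diagonal fun i => (c : ℂ) - (hA.eigenvalues i : ℂ)).PosSemidef :=
    PosSemidef.diagonal fun i => by
      simpa using hc i
  have hU : (hA.eigenvectorUnitary : Matrix m m ℂ) * (hA.eigenvectorUnitary : Matrix m m ℂ)ᴴ = 1 :=
    Unitary.coe_mul_star_self hA.eigenvectorUnitary
  convert hD.mul_mul_conjTranspose_same (hA.eigenvectorUnitary : Matrix m m ℂ) using 1
  have hA' := hA.spectral_theorem
  rw [Unitary.conjStarAlgAut_apply] at hA'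
  rw [← diagonal_sub, Matrix.mul_sub, Matrix.sub_mul]
  congr 1
  rw [← smul_one_eq_diagonal, Matrix.mul_smul, Matrix.smul_mul, Matrix.mul_one, hU]

/-- Necessity direction of the equality condition in Proposition 1:
let `λ` be the largest eigenvalue occurring among the density matrices `ρ x` (equivalently,
the maximum of their operator norms). If a POVM `M` achieves success probability
`(d/n) * λ` for the uniform prior `1/n`, then `M x * ρ x = λ • M x` for every `x`. -/
theorem eigen_condition_of_success_prob_eq
    (d n : ℕ) (ρ M : Fin n → Matrix (Fin d) (Fin d) ℂ)
    (hρpsd : ∀ x, (ρ x).PosSemidef) (hρtr : ∀ x, (ρ x).trace = 1)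
    (lam : ℝ)
    (hlam : IsGreatest {r : ℝ | ∃ x i, r = (hρpsd x).1.eigenvalues i} lam)
    (hMpsd : ∀ x, (M x).PosSemidef) (hMsum : ∑ x, M x = 1)
    (hopt : (1 / n : ℝ) * ∑ x, ((ρ x * M x).trace).re = (d / n : ℝ) * lam) :
    ∀ x, M x * ρ x = (lam : ℂ) • M x := by
  intro x
  have hn : (n : ℝ) ≠ 0 := Nat.cast_ne_zero.mpr fun h => (h ▸ x).elim0
  have hpsd : ∀ y, ((lam : ℂ) • (1 : Matrix (Fin d) (Fin d) ℂ) - ρ y).PosSemidef := fun y =>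
    (hρpsd y).1.posSemidef_smul_one_sub fun i => hlam.2 ⟨y, i, rfl⟩
  have hsum : ∑ y, ((ρ y * M y).trace).re = d * lam := by
    field_simp at hopt
    exact hopt
  have htr : ∑ y, ((M y).trace).re = d := by
    rw [← Complex.re_sum, ← trace_sum, hMsum]
    simp
  have hnonneg := fun y => (hMpsd y).trace_mul_nonneg (hpsd y)
  have hre : ∀ y, ((M y * ((lam : ℂ) • 1 - ρ y)).trace).re =
      lam * ((M y).trace).re - ((ρ y * M y).trace).re := fun y => by
    rw [Matrix.mul_sub, trace_sub, trace_mul_comm (M y) (ρ y)]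
    simp
  have hzero : ∑ y, ((M y * ((lam : ℂ) • 1 - ρ y)).trace).re = 0 := by
    simp only [hre, Finset.sum_sub_distrib, ← Finset.mul_sum, hsum, htr]
    ring
  have hx : ((M x * ((lam : ℂ) • 1 - ρ x)).trace).re = 0 :=
    (Finset.sum_eq_zero_iff_of_nonneg fun y _ => (Complex.le_def.mp (hnonneg y)).1).mp hzero x
      (Finset.mem_univ x)
  have hmul := (hMpsd x).mul_eq_zero_of_trace_mul_eq_zero (hpsd x)
    (Complex.ext hx (Complex.le_def.mp (hnonneg x)).2.symm)
  rw [Matrix.mul_sub, Matrix.mul_smul, Matrix.mul_one, sub_eq_zero] at hmul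
  exact hmul.symm
end

section
/- In the basis encoding scheme with k bases and the parity partition, the optimal success probability with metainformation followed by post-measurement side information is P_meta = (1/k)·(1 + ½·max_{i,j} ‖n_i − n_j‖). Precisely: the supremum, over all POVMs C with outcome set {1,…,k}×{1,…,k}, of (1/(2k)) ∑_{i,j=1}^k [tr(ρ_{i,+1} C(i,j)) + tr(ρ_{j,−1} C(i,j))], equals (1/k)(1 + ½ max_{i,j} ‖n_i − n_j‖); here ½‖n_i − n_j‖ = sin(θ_ij/2) and the maximum equals sin(θ*/2) with θ* = max_{i,j} θ_ij. -/
open Matrix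
open scoped ComplexOrder

noncomputable section

def σx : Matrix (Fin 2) (Fin 2) ℂ := !![0, 1; 1, 0]
def σy : Matrix (Fin 2) (Fin 2) ℂ := !![0, -Complex.I; Complex.I, 0]
def σz : Matrix (Fin 2) (Fin 2) ℂ := !![1, 0; 0, -1]

/-- `v ⬝ σ` for a Bloch vector `v ∈ ℝ³`. -/
def dotSigma (v : EuclideanSpace ℝ (Fin 3)) : Matrix (Fin 2) (Fin 2) ℂ :=
  v 0 • σx + v 1 • σy + v 2 • σz

/-- Sign of a parity bit: `true ↦ +1`, `false ↦ -1`. -/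
def sgn (b : Bool) : ℝ := if b then 1 else -1

/-- The qubit state `½(I + p · v ⬝ σ)`. -/
def basisState (v : EuclideanSpace ℝ (Fin 3)) (p : Bool) : Matrix (Fin 2) (Fin 2) ℂ :=
  (1 / 2 : ℝ) • (1 + sgn p • dotSigma v)

lemma re_trace_dotSigma_mul_le (v : EuclideanSpace ℝ (Fin 3)) {C : Matrix (Fin 2) (Fin 2) ℂ}
    (hC : C.PosSemidef) : ((dotSigma v * C).trace).re ≤ ‖v‖ * C.trace.re := by
  have h00 := hC.diag_nonneg (i := 0)
  have h11 := hC.diag_nonneg (i := 1)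
  have hdet := hC.det_nonneg
  have h10 := hC.isHermitian.apply 1 0
  rw [Matrix.det_fin_two, ← h10] at hdet
  rw [Complex.le_def] at h00 h11 hdet
  obtain ⟨h00, h00'⟩ := h00
  obtain ⟨h11, h11'⟩ := h11
  obtain ⟨hdet, -⟩ := hdet
  simp only [Complex.zero_re, Complex.zero_im, Complex.sub_re, Complex.mul_re, Complex.star_def,
    Complex.conj_re, Complex.conj_im, ← h00'] at h00 h11 h00' h11' hdet
  have htr : ((dotSigma v * C).trace).re =
      v 0 * (2 * (C 0 1).re) + v 1 * (-2 * (C 0 1).im) + v 2 * ((C 0 0).re - (C 1 1).re) := by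
    simp [dotSigma, σx, σy, σz, Matrix.trace_fin_two, Matrix.vecMul, dotProduct,
      Fin.sum_univ_two, ← h10]
    ring
  have htrC : C.trace.re = (C 0 0).re + (C 1 1).re := by simp [Matrix.trace_fin_two]
  have hv : ‖v‖ ^ 2 = v 0 ^ 2 + v 1 ^ 2 + v 2 ^ 2 := by
    rw [EuclideanSpace.real_norm_sq_eq, Fin.sum_univ_three]
  rw [htr, htrC]
  generalize (C 0 1).re = x at *
  generalize (C 0 1).im = y at *
  generalize (C 0 0).re = a at *
  generalize (C 1 1).re = d at *
  have hw : (2 * x) ^ 2 + (-2 * y) ^ 2 + (a - d) ^ 2 ≤ (a + d) ^ 2 := by nlinarith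
  refine le_of_sq_le_sq ?_ (by positivity)
  calc (v 0 * (2 * x) + v 1 * (-2 * y) + v 2 * (a - d)) ^ 2
      ≤ (v 0 ^ 2 + v 1 ^ 2 + v 2 ^ 2) * ((2 * x) ^ 2 + (-2 * y) ^ 2 + (a - d) ^ 2) := by
        nlinarith [sq_nonneg (v 0 * (-2 * y) - v 1 * (2 * x)),
          sq_nonneg (v 0 * (a - d) - v 2 * (2 * x)), sq_nonneg (v 1 * (a - d) - v 2 * (-2 * y))]
    _ ≤ (‖v‖ * (a + d)) ^ 2 := by
        rw [← hv, mul_pow ‖v‖]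
        exact mul_le_mul_of_nonneg_left hw (sq_nonneg _)

lemma dotSigma_isHermitian (v : EuclideanSpace ℝ (Fin 3)) : (dotSigma v).IsHermitian := by
  ext i j
  fin_cases i <;> fin_cases j <;> simp [dotSigma, σx, σy, σz]

lemma dotSigma_mul_self {v : EuclideanSpace ℝ (Fin 3)} (hv : ‖v‖ = 1) :
    dotSigma v * dotSigma v = 1 := by
  have h : v 0 ^ 2 + v 1 ^ 2 + v 2 ^ 2 = 1 := by
    rw [← Fin.sum_univ_three (fun i => v i ^ 2), ← EuclideanSpace.real_norm_sq_eq, hv, one_pow]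
  have h' : (v 0 : ℂ) ^ 2 + (v 1 : ℂ) ^ 2 + (v 2 : ℂ) ^ 2 = 1 := by
    simpa using congrArg Complex.ofReal h
  ext i j
  fin_cases i <;> fin_cases j <;>
    simp [dotSigma, σx, σy, σz, Matrix.mul_apply, Fin.sum_univ_two] <;>
    ring_nf <;>
    linear_combination h' - (v 1 : ℂ) ^ 2 * Complex.I_sq

lemma basisState_posSemidef {v : EuclideanSpace ℝ (Fin 3)} (hv : ‖v‖ = 1) (p : Bool) :
    (basisState v p).PosSemidef := by
  have hH : (basisState v p)ᴴ = basisState v p := by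
    simp [basisState, Matrix.conjTranspose_smul, (dotSigma_isHermitian v).eq]
  have hs : sgn p * sgn p = 1 := by cases p <;> simp [sgn]
  have hP : basisState v p = (basisState v p)ᴴ * basisState v p := by
    rw [hH]
    simp only [basisState, smul_mul_smul_comm, add_mul, mul_add, one_mul, mul_one,
      dotSigma_mul_self hv, hs]
    module
  rw [hP]
  exact Matrix.posSemidef_conjTranspose_mul_self _

lemma basisState_true_add_false (v : EuclideanSpace ℝ (Fin 3)) :
    basisState v true + basisState v false = 1 := by
  simp only [basisState, sgn]
  simp only [if_true, Bool.false_eq_true, if_false]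
  module

lemma re_trace_basisState_add (v w : EuclideanSpace ℝ (Fin 3)) (C : Matrix (Fin 2) (Fin 2) ℂ) :
    ((basisState v true * C).trace).re + ((basisState w false * C).trace).re =
      C.trace.re + (1 / 2) * ((dotSigma (v - w) * C).trace).re := by
  simp [basisState, sgn, dotSigma, σx, σy, σz, Matrix.trace_fin_two, Matrix.mul_apply,
    Matrix.vecMul, dotProduct, Fin.sum_univ_two]
  ring

lemma re_trace_basisState (v : EuclideanSpace ℝ (Fin 3)) (p : Bool) :
    (basisState v p).trace.re = 1 := by
  simp [basisState, dotSigma, σx, σy, σz, Matrix.trace_fin_two]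

lemma re_trace_dotSigma_mul_basisState {u : EuclideanSpace ℝ (Fin 3)} (hu : ‖u‖ = 1) (t : ℝ)
    (p : Bool) : ((dotSigma (t • u) * basisState u p).trace).re = sgn p * t := by
  have h : u 0 ^ 2 + u 1 ^ 2 + u 2 ^ 2 = 1 := by
    rw [← Fin.sum_univ_three (fun i => u i ^ 2), ← EuclideanSpace.real_norm_sq_eq, hu, one_pow]
  simp [basisState, dotSigma, σx, σy, σz, Matrix.trace_fin_two, Matrix.vecMul,
    dotProduct, Fin.sum_univ_two]
  linear_combination sgn p * t * h

lemma exists_norm_one_smul_eq (d e : EuclideanSpace ℝ (Fin 3)) (he : ‖e‖ = 1) :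
    ∃ u : EuclideanSpace ℝ (Fin 3), ‖u‖ = 1 ∧ d = ‖d‖ • u := by
  by_cases hd : d = 0
  · exact ⟨e, he, by simp [hd]⟩
  · exact ⟨‖d‖⁻¹ • d, norm_smul_inv_norm (𝕜 := ℝ) hd, by
      rw [smul_smul, mul_inv_cancel₀ (norm_ne_zero_iff.mpr hd), one_smul]⟩

lemma sum_apply_single_add_single {ι M : Type*} [Fintype ι] [DecidableEq ι] [AddCommMonoid M]
    (F : ι → M → ℝ) (h_zero : ∀ i, F i 0 = 0) (h_add : ∀ i x y, F i (x + y) = F i x + F i y)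
    (a b : ι) (x y : M) :
    ∑ i, F i ((Pi.single a x + Pi.single b y : ι → M) i) = F a x + F b y := by
  have h_single (c : ι) (z : M) : ∑ i, F i ((Pi.single c z : ι → M) i) = F c z := by
    rw [Finset.sum_eq_single c (fun i _ h => by rw [Pi.single_eq_of_ne h, h_zero]) (by simp),
      Pi.single_eq_same]
  simp only [Pi.add_apply, h_add, Finset.sum_add_distrib, h_single]

/-- Basis encoding with `k` bases and the parity partition: the optimal success
probability with metainformation followed by post-measurement side information, i.e. the optimum
over all POVMs `C` indexed by pairs `(i,j) ∈ {1,…,k}²` of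
`(1/(2k)) ∑_{i,j} (tr(ρ_{i,+} C(i,j)) + tr(ρ_{j,-} C(i,j)))`, equals
`(1/k)(1 + ½ · max_{i,j} ‖n i - n j‖)`. -/
theorem meta_info_value_parity_partition
    (k : ℕ) (hk : 0 < k) (n : Fin k → EuclideanSpace ℝ (Fin 3))
    (hn : ∀ i, ‖n i‖ = 1) :
    IsGreatest {P : ℝ | ∃ C : Fin k × Fin k → Matrix (Fin 2) (Fin 2) ℂ,
        (∀ ij, (C ij).PosSemidef) ∧ (∑ ij, C ij = 1) ∧
        P = (1 / (2 * k) : ℝ) * ∑ ij : Fin k × Fin k,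
              (((basisState (n ij.1) true * C ij).trace).re +
                ((basisState (n ij.2) false * C ij).trace).re)}
      ((1 / k : ℝ) * (1 + (1 / 2) *
        Finset.univ.sup' ⟨((⟨0, hk⟩, ⟨0, hk⟩) : Fin k × Fin k), Finset.mem_univ _⟩
          (fun ij : Fin k × Fin k => ‖n ij.1 - n ij.2‖))) := by
  have hk' : (0 : ℝ) < k := by exact_mod_cast hk
  set f : Fin k × Fin k → ℝ := fun ij => ‖n ij.1 - n ij.2‖ with hf
  have hne : (Finset.univ : Finset (Fin k × Fin k)).Nonempty :=
    ⟨(⟨0, hk⟩, ⟨0, hk⟩), Finset.mem_univ _⟩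
  change IsGreatest _ ((1 / k : ℝ) * (1 + (1 / 2) * Finset.univ.sup' hne f))
  simp only [re_trace_basisState_add]
  constructor
  · obtain ⟨⟨a, b⟩, -, hab⟩ := Finset.exists_mem_eq_sup' hne f
    rw [hab]
    obtain ⟨u, hu, hd⟩ := exists_norm_one_smul_eq (n a - n b) (n a) (hn a)
    have hd' : n b - n a = (-‖n a - n b‖) • u := by rw [neg_smul, ← hd, neg_sub]
    refine ⟨Pi.single (a, b) (basisState u true) + Pi.single (b, a) (basisState u false),
      fun ij => ?_, ?_, ?_⟩
    · refine Matrix.PosSemidef.add ?_ ?_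
      · rw [Pi.single_apply]
        split_ifs
        exacts [basisState_posSemidef hu _, Matrix.PosSemidef.zero]
      · rw [Pi.single_apply]
        split_ifs
        exacts [basisState_posSemidef hu _, Matrix.PosSemidef.zero]
    · simp only [Pi.add_apply, Finset.sum_add_distrib, Finset.sum_pi_single', Finset.mem_univ,
        if_true]
      exact basisState_true_add_false u
    · rw [sum_apply_single_add_single
        (fun (ij : Fin k × Fin k) (C : Matrix (Fin 2) (Fin 2) ℂ) =>
          C.trace.re + (1 / 2) * ((dotSigma (n ij.1 - n ij.2) * C).trace).re)
        (fun _ => by simp)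
        (fun _ _ _ => by simp only [Matrix.trace_add, mul_add, Complex.add_re]; ring)]
      have h1 : ((dotSigma (n a - n b) * basisState u true).trace).re = ‖n a - n b‖ := by
        conv_lhs => rw [hd]
        rw [re_trace_dotSigma_mul_basisState hu]
        simp [sgn]
      have h2 : ((dotSigma (n b - n a) * basisState u false).trace).re = ‖n a - n b‖ := by
        rw [hd', re_trace_dotSigma_mul_basisState hu]
        simp [sgn]
      simp only [re_trace_basisState, h1, h2, hf]
      field_simp
      ring
  · rintro P ⟨C, hC, hsum, rfl⟩
    set m := Finset.univ.sup' hne f with hm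
    have htr : ∑ ij, (C ij).trace.re = 2 := by
      rw [← Complex.re_sum, ← Matrix.trace_sum, hsum]
      simp
    have hle (ij : Fin k × Fin k) :
        (C ij).trace.re + (1 / 2) * ((dotSigma (n ij.1 - n ij.2) * C ij).trace).re ≤
          (C ij).trace.re * (1 + (1 / 2) * m) := by
      have h1 := re_trace_dotSigma_mul_le (n ij.1 - n ij.2) (hC ij)
      have h2 : f ij ≤ m := Finset.le_sup' f (Finset.mem_univ ij)
      have h3 : 0 ≤ (C ij).trace.re := (Complex.le_def.mp (hC ij).trace_nonneg).1
      have h4 := mul_le_mul_of_nonneg_right h2 h3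
      simp only [hf] at h4
      linarith
    calc _ ≤ (1 / (2 * k) : ℝ) * ∑ ij, (C ij).trace.re * (1 + (1 / 2) * m) := by
          gcongr with ij
          exact hle ij
      _ = _ := by
          rw [← Finset.sum_mul, htr]
          field_simp
end
end

section
/- Consider the tetrahedron ensemble of four pure qubit states ρ_{ℓ,±} (ℓ = 1,2) with |ψ_{1+}⟩ = |0⟩, |ψ_{1−}⟩ = (1/√3)|0⟩ + √(2/3)|1⟩, |ψ_{2±}⟩ = (1/√3)|0⟩ + e^{±2πi/3}√(2/3)|1⟩, uniform prior 1/4, partitioned into X_1 = {1+,1−}, X_2 = {2+,2−}, with part states ρ_ℓ = ½(ρ_{ℓ+} + ρ_{ℓ−}). The anticipative maximum-confidence measurements have effects N(ℓ,±) = a_{ℓ±}·(I − ρ_{ℓ∓}) with scalars a_{ℓ±} ∈ [0,1] subject to ∑_{ℓ,p} a_{ℓp}(I − ρ_{ℓ,−p}) ≤ I. The optimal conclusive rate with metainformation is R_meta = 1/3; that is, the supremum over admissible scalars (a_{ℓp}) of ∑_{ℓ=1}^2 ½ tr(ρ_ℓ (a_{ℓ+}(I − ρ_{ℓ−}) + a_{ℓ−}(I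 − ρ_{ℓ+}))) equals 1/3. -/
open Matrix
open scoped ComplexOrder

noncomputable section

/-- The unit vectors of the tetrahedron ensemble: `ψ_{1+} = |0⟩`,
`ψ_{1-} = (1/√3)|0⟩ + √(2/3)|1⟩`, `ψ_{2±} = (1/√3)|0⟩ + e^{±2πi/3}√(2/3)|1⟩`. -/
def tetraVec (l : Fin 2) (p : Bool) : Fin 2 → ℂ :=
  if l = 0 then
    (if p then ![1, 0] else ![((1 / Real.sqrt 3 : ℝ) : ℂ), ((Real.sqrt (2 / 3) : ℝ) : ℂ)])
  else
    ![((1 / Real.sqrt 3 : ℝ) : ℂ),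
      Complex.exp (((sgn p * (2 * Real.pi / 3) : ℝ) : ℂ) * Complex.I) *
        ((Real.sqrt (2 / 3) : ℝ) : ℂ)]

/-- The tetrahedron states `ρ_x = |ψ_x⟩⟨ψ_x|`. -/
def tetraState (l : Fin 2) (p : Bool) : Matrix (Fin 2) (Fin 2) ℂ :=
  Matrix.vecMulVec (tetraVec l p) (fun i => star (tetraVec l p i))

/-- The average state of each part, `ρ_ℓ = ½(ρ_{ℓ+} + ρ_{ℓ-})`. -/
def tetraPart (l : Fin 2) : Matrix (Fin 2) (Fin 2) ℂ :=
  (1 / 2 : ℝ) • (tetraState l true + tetraState l false)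

theorem tetraState_zero_true : tetraState 0 true = !![1, 0; 0, 0] := by
  ext i j
  fin_cases i <;> fin_cases j <;> simp [tetraState, tetraVec, vecMulVec]

theorem inv_sqrt_three_mul_self : (1 / Real.sqrt 3) * (1 / Real.sqrt 3) = 1 / 3 := by
  rw [div_mul_div_comm, Real.mul_self_sqrt (by norm_num), one_mul]

theorem sqrt_two_thirds_mul_self : Real.sqrt (2 / 3) * Real.sqrt (2 / 3) = 2 / 3 :=
  Real.mul_self_sqrt (by norm_num)

theorem inv_sqrt_three_mul_sqrt_two_thirds :
    (1 / Real.sqrt 3) * Real.sqrt (2 / 3) = Real.sqrt 2 / 3 := by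
  rw [Real.sqrt_div (by norm_num), div_mul_div_comm, Real.mul_self_sqrt (by norm_num), one_mul]

theorem tetraState_zero_false :
    tetraState 0 false =
      !![1 / 3, ((Real.sqrt 2 / 3 : ℝ) : ℂ); ((Real.sqrt 2 / 3 : ℝ) : ℂ), 2 / 3] := by
  have h₁ := congrArg Complex.ofReal inv_sqrt_three_mul_self
  have h₂ := congrArg Complex.ofReal sqrt_two_thirds_mul_self
  have h₃ := congrArg Complex.ofReal inv_sqrt_three_mul_sqrt_two_thirds
  rw [Complex.ofReal_mul] at h₁ h₂ h₃
  ext i j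
  fin_cases i <;> fin_cases j <;>
    simp only [tetraState, tetraVec, vecMulVec, Matrix.of_apply, RCLike.star_def, if_true,
      Bool.false_eq_true, if_false, Fin.zero_eta, Fin.mk_one, Matrix.cons_val_zero,
      Matrix.cons_val_one, Matrix.cons_val_fin_one, Complex.conj_ofReal]
  · rw [h₁]; norm_num
  · rw [h₃]
  · rw [mul_comm, h₃]
  · rw [h₂]; norm_num

theorem cos_two_pi_div_three : Real.cos (2 * Real.pi / 3) = -1 / 2 := by
  rw [show 2 * Real.pi / 3 = Real.pi - Real.pi / 3 by ring, Real.cos_pi_sub, Real.cos_pi_div_three]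
  norm_num

theorem sin_two_pi_div_three : Real.sin (2 * Real.pi / 3) = Real.sqrt 3 / 2 := by
  rw [show 2 * Real.pi / 3 = Real.pi - Real.pi / 3 by ring, Real.sin_pi_sub, Real.sin_pi_div_three]

theorem exp_sgn_mul_two_pi_div_three (p : Bool) :
    Complex.exp (((sgn p * (2 * Real.pi / 3) : ℝ) : ℂ) * Complex.I) =
      ⟨-1 / 2, sgn p * (Real.sqrt 3 / 2)⟩ := by
  apply Complex.ext
  · rw [Complex.exp_ofReal_mul_I_re]
    cases p <;> simp [sgn, cos_two_pi_div_three]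
  · rw [Complex.exp_ofReal_mul_I_im]
    cases p <;> simp [sgn, sin_two_pi_div_three]

theorem tetraState_one (p : Bool) :
    tetraState 1 p =
      !![1 / 3, ((Real.sqrt 2 / 3 : ℝ) : ℂ) * ⟨-1 / 2, -(sgn p * (Real.sqrt 3 / 2))⟩;
        ((Real.sqrt 2 / 3 : ℝ) : ℂ) * ⟨-1 / 2, sgn p * (Real.sqrt 3 / 2)⟩, 2 / 3] := by
  have h₁ := congrArg Complex.ofReal inv_sqrt_three_mul_self
  have h₂ := congrArg Complex.ofReal sqrt_two_thirds_mul_self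
  have h₃ := congrArg Complex.ofReal inv_sqrt_three_mul_sqrt_two_thirds
  rw [Complex.ofReal_mul] at h₁ h₂ h₃
  have hn : (⟨-1 / 2, sgn p * (Real.sqrt 3 / 2)⟩ : ℂ) *
      ⟨-1 / 2, -(sgn p * (Real.sqrt 3 / 2))⟩ = 1 := by
    have h := Real.mul_self_sqrt (show (0 : ℝ) ≤ 3 by norm_num)
    have hs : sgn p * sgn p = 1 := by cases p <;> norm_num [sgn]
    apply Complex.ext
    · simp only [Complex.mul_re, Complex.one_re]
      linear_combination (1 / 4 : ℝ) * (sgn p * sgn p) * h + (3 / 4 : ℝ) * hs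
    · simp only [Complex.mul_im, Complex.one_im]
      ring
  have hc : (starRingEnd ℂ) ⟨-1 / 2, sgn p * (Real.sqrt 3 / 2)⟩ =
      ⟨-1 / 2, -(sgn p * (Real.sqrt 3 / 2))⟩ := rfl
  ext i j
  fin_cases i <;> fin_cases j <;>
    simp only [tetraState, tetraVec, vecMulVec, Matrix.of_apply, RCLike.star_def, one_ne_zero,
      if_false, Fin.zero_eta, Fin.mk_one, Matrix.cons_val_zero, exp_sgn_mul_two_pi_div_three,
      Matrix.cons_val_one, Matrix.cons_val_fin_one, Complex.conj_ofReal, map_mul, hc]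
  · rw [h₁]; norm_num
  · rw [← h₃]; ring
  · rw [← h₃]; ring
  · rw [mul_mul_mul_comm, hn, h₂]; norm_num

theorem sum_tetraState : ∑ l : Fin 2, ∑ p : Bool, tetraState l p = (2 : ℝ) • 1 := by
  rw [Fin.sum_univ_two, Fintype.sum_bool, Fintype.sum_bool, tetraState_zero_true,
    tetraState_zero_false, tetraState_one, tetraState_one]
  ext i j
  fin_cases i <;> fin_cases j <;> apply Complex.ext <;> simp [sgn] <;> ring

theorem trace_tetraState (l : Fin 2) (p : Bool) : (tetraState l p).trace = 1 := by
  fin_cases l <;> cases p <;>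
    simp [tetraState_zero_true, tetraState_zero_false, tetraState_one, Matrix.trace_fin_two] <;>
    norm_num

theorem trace_tetraState_mul_self (l : Fin 2) (p : Bool) :
    (tetraState l p * tetraState l p).trace = 1 := by
  have h : tetraVec l p ⬝ᵥ (fun i => star (tetraVec l p i)) = 1 := by
    rw [← trace_tetraState l p, tetraState, Matrix.trace_vecMulVec]
  rw [tetraState, Matrix.vecMulVec_mul_vecMulVec, dotProduct_comm, h, one_smul,
    Matrix.trace_vecMulVec, h]

theorem trace_tetraState_mul_not (l : Fin 2) (p : Bool) :
    (tetraState l p * tetraState l (!p)).trace = 1 / 3 := by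
  have h₂ := Real.mul_self_sqrt (show (0 : ℝ) ≤ 2 by norm_num)
  have h₃ := Real.mul_self_sqrt (show (0 : ℝ) ≤ 3 by norm_num)
  fin_cases l
  · cases p <;>
      simp [tetraState_zero_true, tetraState_zero_false, Matrix.trace_fin_two]
  · cases p <;>
    · simp only [Fin.mk_one, Bool.not_true, Bool.not_false, tetraState_one, Matrix.trace_fin_two,
        Matrix.mul_fin_two]
      apply Complex.ext <;> simp [sgn]
      · linear_combination (-1 / 9 : ℝ) * h₂ - (1 / 18 : ℝ) * (Real.sqrt 2 * Real.sqrt 2) * h₃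
      · ring

theorem trace_tetraPart_mul (l : Fin 2) (a b : ℝ) :
    (tetraPart l * (a • (1 - tetraState l false) + b • (1 - tetraState l true))).trace =
      ((1 / 3 * (a + b) : ℝ) : ℂ) := by
  have h₁ := trace_tetraState_mul_not l true
  have h₂ := trace_tetraState_mul_not l false
  simp only [Bool.not_true, Bool.not_false] at h₁ h₂
  simp only [tetraPart, smul_mul_assoc, mul_add, add_mul, mul_smul_comm, mul_sub, mul_one,
    trace_smul, trace_add, trace_sub, trace_tetraState, trace_tetraState_mul_self, h₁, h₂,
    Complex.real_smul]
  push_cast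
  ring

/-- Tetrahedron ensemble with uniform prior `1/4` and partition
`X_ℓ = {(ℓ,+),(ℓ,-)}`: the anticipative maximum-confidence measurements have effects
`N(ℓ,±) = a_{ℓ±} • (I - ρ_{ℓ∓})` with `a_{ℓ±} ∈ [0,1]` constrained so that the effects form
a sub-POVM, and the optimal conclusive rate with metainformation,
`sup ∑_ℓ ½ tr(ρ_ℓ (a_{ℓ+}(I - ρ_{ℓ-}) + a_{ℓ-}(I - ρ_{ℓ+})))`, equals `1/3` (attained). -/
theorem tetrahedron_meta_conclusive_rate :
    IsGreatest {R : ℝ | ∃ a : Fin 2 → Bool → ℝ,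
        (∀ l p, 0 ≤ a l p) ∧ (∀ l p, a l p ≤ 1) ∧
        ((1 : Matrix (Fin 2) (Fin 2) ℂ) -
          ∑ l : Fin 2, ∑ p : Bool,
            a l p • ((1 : Matrix (Fin 2) (Fin 2) ℂ) - tetraState l (!p))).PosSemidef ∧
        R = ∑ l : Fin 2, (1 / 2 : ℝ) *
          ((tetraPart l *
            (a l true • ((1 : Matrix (Fin 2) (Fin 2) ℂ) - tetraState l false) +
             a l false • ((1 : Matrix (Fin 2) (Fin 2) ℂ) - tetraState l true))).trace).re}
      (1 / 3 : ℝ) := by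
  have rate (a : Fin 2 → Bool → ℝ) :
      ∑ l : Fin 2, (1 / 2 : ℝ) *
          ((tetraPart l *
            (a l true • ((1 : Matrix (Fin 2) (Fin 2) ℂ) - tetraState l false) +
             a l false • ((1 : Matrix (Fin 2) (Fin 2) ℂ) - tetraState l true))).trace).re =
        1 / 6 * ∑ l : Fin 2, ∑ p : Bool, a l p := by
    simp only [trace_tetraPart_mul, Complex.ofReal_re, Fin.sum_univ_two, Fintype.sum_bool]
    ring
  constructor
  · refine ⟨fun _ _ => 1 / 2, fun _ _ => by norm_num, fun _ _ => by norm_num, ?_, ?_⟩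
    · have h : ∑ l : Fin 2, ∑ p : Bool,
          (1 / 2 : ℝ) • ((1 : Matrix (Fin 2) (Fin 2) ℂ) - tetraState l (!p)) = 1 := by
        have hs := sum_tetraState
        simp only [Fin.sum_univ_two, Fintype.sum_bool, Bool.not_true, Bool.not_false] at hs ⊢
        linear_combination (norm := module) (-1 / 2 : ℝ) • hs
      rw [h, sub_self]
      exact PosSemidef.zero
    · refine Eq.trans ?_ (rate fun _ _ => 1 / 2).symm
      norm_num
  · rintro R ⟨a, -, -, hpsd, rfl⟩
    rw [rate]
    have h := (Complex.le_def.1 hpsd.trace_nonneg).1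
    simp only [trace_sub, trace_sum, trace_smul, trace_one, trace_tetraState, Fintype.card_fin,
      Complex.real_smul] at h
    simp only [Fin.sum_univ_two, Fintype.sum_bool] at h ⊢
    norm_num at h
    linarith
end
end
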